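/- arXiv:2008.12998 — 6 statements merged into one kernel-verified Lean document; each statement's English description precedes it below -/
import Mathlib

section
/- Let C be a linear code over F_q and let w_min and w_max denote the minimum and maximum nonzero Hamming weights of codewords of C. If w_min / w_max > (q−1)/q, then C is a minimal linear code. -/
/-- If `supp y ⊆ supp x`, the total Hamming weight of the translates `y - a • x` is
`(q - 1) * wt x`: each coordinate of `supp x` vanishes for exactly one scalar `a`. -/
theorem sum_hammingNorm_sub_smul {ι F : Type*} [Fintype ι] [Field F] [Fintype F] [DecidableEq F]
    {x y : ι → F} (h : Function.support y ⊆ Function.support x) :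
    ∑ a : F, hammingNorm (y - a • x) = (Fintype.card F - 1) * hammingNorm x := by
  simp only [hammingNorm, Finset.card_filter]
  rw [Finset.sum_comm, Finset.mul_sum]
  refine Finset.sum_congr rfl fun i _ => ?_
  by_cases hx : x i = 0
  · have hy : y i = 0 := by
      by_contra hy
      exact h hy hx
    simp [hx, hy]
  · have key : ∀ a : F, (y - a • x) i ≠ 0 ↔ a ≠ y i / x i := fun a => by
      rw [Pi.sub_apply, Pi.smul_apply, smul_eq_mul, sub_ne_zero, ne_comm, ne_eq, ne_eq,
        eq_div_iff hx]
    simp only [key]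
    rw [← Finset.card_filter, Finset.filter_ne', Finset.card_erase_of_mem (Finset.mem_univ _),
      Finset.card_univ]
    simp [hx]

/-- **Ashikhmin–Barg condition.**  Let `C` be a linear code over `F_q` and let
`wmin` and `wmax` denote the minimum and maximum nonzero Hamming weights of
codewords of `C`.  If `wmin / wmax > (q-1)/q`, then `C` is a minimal linear
code, i.e. every nonzero codeword `c` of `C` covers only the scalar multiples
of `c`. -/
theorem ashikhmin_barg_condition {n : ℕ} {F : Type*} [Field F] [Fintype F] [DecidableEq F]
    (C : Submodule F (Fin n → F)) (wmin wmax : ℕ)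
    (hmin : IsLeast {w : ℕ | ∃ c ∈ C, c ≠ 0 ∧ hammingNorm c = w} wmin)
    (hmax : IsGreatest {w : ℕ | ∃ c ∈ C, c ≠ 0 ∧ hammingNorm c = w} wmax)
    (hAB : (wmin : ℚ) / (wmax : ℚ) > ((Fintype.card F : ℚ) - 1) / (Fintype.card F : ℚ)) :
    ∀ c ∈ C, c ≠ 0 → ∀ c' ∈ C,
      Function.support c' ⊆ Function.support c → ∃ a : F, c' = a • c := by
  intro c hc hc0 c' hc' hsupp
  by_contra! hne
  have hlow : Fintype.card F * wmin ≤ (Fintype.card F - 1) * hammingNorm c := by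
    rw [← sum_hammingNorm_sub_smul hsupp, ← smul_eq_mul, ← Finset.card_univ]
    exact Finset.card_nsmul_le_sum _ _ _ fun a _ =>
      hmin.2 ⟨_, C.sub_mem hc' (C.smul_mem a hc), sub_ne_zero.2 (hne a), rfl⟩
  have hle : hammingNorm c ≤ wmax := hmax.2 ⟨c, hc, hc0, rfl⟩
  have hpos : 0 < wmax := (hammingNorm_pos_iff.2 hc0).trans_le hle
  have hq : 0 < Fintype.card F := Fintype.card_pos
  rw [gt_iff_lt, div_lt_div_iff₀ (by exact_mod_cast hq) (by exact_mod_cast hpos)] at hAB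
  have hup : (Fintype.card F : ℚ) * wmin ≤ ((Fintype.card F : ℚ) - 1) * wmax := by
    have := hlow.trans (Nat.mul_le_mul_left _ hle)
    rw [← Nat.cast_pred hq]
    exact_mod_cast this
  linarith
end

section
/- A linear code C ⊆ F_q^n over F_q is minimal if and only if for every pair of F_q-linearly independent codewords c, c' of C one has Σ_{a ∈ F_q^*} wt(c' + a·c) ≠ (q−1)·wt(c') − wt(c). -/
open Finset in
theorem sum_ite_add_mul_ne_zero {F : Type*} [Field F] [Fintype F] [DecidableEq F] (x y : F) :
    (∑ a ∈ univ \ {(0 : F)}, if y + a * x ≠ 0 then (1 : ℤ) else 0) =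
      ((Fintype.card F : ℤ) - 1) * (if y ≠ 0 then 1 else 0) - (if x ≠ 0 then 1 else 0) +
        (Fintype.card F : ℤ) * (if x ≠ 0 ∧ y = 0 then 1 else 0) := by
  have hsum : (∑ _a ∈ univ \ {(0 : F)}, (1 : ℤ)) = (Fintype.card F : ℤ) - 1 := by
    have h := sum_sdiff (f := fun _ : F => (1 : ℤ)) (subset_univ {0})
    rw [sum_singleton, ← eq_sub_iff_add_eq] at h
    simpa using h
  by_cases hx : x = 0
  · by_cases hy : y = 0
    · simp [hx, hy]
    · simpa [hx, hy] using hsum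
  · by_cases hy : y = 0
    · have h : ∀ a ∈ univ \ {(0 : F)}, (if y + a * x ≠ 0 then (1 : ℤ) else 0) = 1 := by
        intro a ha
        simp_all
      rw [sum_congr rfl h, hsum]
      simp [hx, hy, sub_eq_neg_add]
    · have h : ∀ a : F, (if y + a * x ≠ 0 then (1 : ℤ) else 0) =
          1 - if a = -y / x then 1 else 0 := by
        intro a
        have : y + a * x = 0 ↔ a = -y / x := by
          rw [eq_div_iff hx, eq_neg_iff_add_eq_zero, add_comm]
        simp only [ne_eq, this]
        split_ifs <;> simp_all
      have hmem : -y / x ∈ univ \ {(0 : F)} := by simp [hx, hy]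
      simp_rw [h]
      rw [sum_sub_distrib, hsum, sum_ite_eq', if_pos hmem]
      simp [hx, hy]

open Finset in
/-- Over `F`, the weights of `c' + a • c` for `a ≠ 0` sum to `(q - 1) wt(c') - wt(c)` plus `q` times
the number of coordinates in the support of `c` but not in that of `c'`. -/
theorem sum_hammingNorm_add_smul {ι F : Type*} [Fintype ι] [Field F] [Fintype F] [DecidableEq F]
    (c c' : ι → F) :
    (∑ a ∈ univ \ {(0 : F)}, (hammingNorm (c' + a • c) : ℤ)) =
      ((Fintype.card F : ℤ) - 1) * (hammingNorm c' : ℤ) - (hammingNorm c : ℤ) +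
        (Fintype.card F : ℤ) * (#{i | c i ≠ 0 ∧ c' i = 0} : ℤ) := by
  have hnorm (x : ι → F) : (hammingNorm x : ℤ) = ∑ i, if x i ≠ 0 then (1 : ℤ) else 0 := by
    rw [hammingNorm, natCast_card_filter]
  simp_rw [hnorm, natCast_card_filter, mul_sum, ← sum_sub_distrib, ← sum_add_distrib]
  rw [sum_comm]
  exact sum_congr rfl fun i _ => sum_ite_add_mul_ne_zero (c i) (c' i)

open Finset in
theorem sum_hammingNorm_add_smul_eq_iff {ι F : Type*} [Fintype ι] [Field F] [Fintype F]
    [DecidableEq F] (c c' : ι → F) :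
    (∑ a ∈ univ \ {(0 : F)}, (hammingNorm (c' + a • c) : ℤ)) =
        ((Fintype.card F : ℤ) - 1) * (hammingNorm c' : ℤ) - (hammingNorm c : ℤ) ↔
      Function.support c ⊆ Function.support c' := by
  have hq : (Fintype.card F : ℤ) ≠ 0 := by exact_mod_cast Fintype.card_ne_zero
  rw [sum_hammingNorm_add_smul, add_eq_left, mul_eq_zero, or_iff_right hq, Nat.cast_eq_zero,
    card_eq_zero, filter_eq_empty_iff]
  simp [Set.subset_def]


/-- **Heng–Ding–Zhou criterion.**  A linear code `C ⊆ F_q^n` is minimal if and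
only if for every pair of `F_q`-linearly independent codewords `c, c'` of `C`
one has `Σ_{a ∈ F_q*} wt(c' + a·c) ≠ (q-1)·wt(c') − wt(c)`. -/
theorem minimal_iff_heng_criterion {n : ℕ} {F : Type*} [Field F] [Fintype F] [DecidableEq F]
    (C : Submodule F (Fin n → F)) :
    (∀ c ∈ C, c ≠ 0 → ∀ c' ∈ C,
        Function.support c' ⊆ Function.support c → ∃ a : F, c' = a • c) ↔
      (∀ c ∈ C, ∀ c' ∈ C, LinearIndependent F ![c, c'] →
        (∑ a ∈ Finset.univ \ {(0 : F)}, (hammingNorm (c' + a • c) : ℤ)) ≠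
          ((Fintype.card F : ℤ) - 1) * (hammingNorm c' : ℤ) - (hammingNorm c : ℤ)) := by
  simp only [ne_eq, sum_hammingNorm_add_smul_eq_iff]
  constructor
  · intro h c hc c' hc' hli hsub
    have hc0 : c' ≠ 0 := hli.ne_zero 1
    obtain ⟨a, ha⟩ := h c' hc' hc0 c hc hsub
    rw [LinearIndependent.pair_symm_iff, LinearIndependent.pair_iff' hc0] at hli
    exact hli a ha.symm
  · intro h c hc hc0 c' hc' hsub
    by_contra! hne
    refine h c' hc' c hc ?_ hsub
    rw [LinearIndependent.pair_symm_iff, LinearIndependent.pair_iff' hc0]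
    exact fun a ha => hne a ha.symm
end

section
/- Let A be a subset of F_{q^m} that is F_q^*-invariant. Then L(A) = {a ∈ F_{q^m} : Ψ_a(A) = |A|}. -/
/-- The canonical additive character `Ψ` of a finite field `E` of
characteristic `p`:  `Ψ(x) = exp(2πi·Tr_{E/F_p}(x)/p)`. -/
noncomputable def canonAddChar (p : ℕ) (E : Type*) [Field E] [CharP E p] (x : E) : ℂ :=
  letI := ZMod.algebra E p
  Complex.exp (2 * Real.pi * Complex.I * ((Algebra.trace (ZMod p) E x).val : ℂ) / p)

/-- The real part of the canonical additive character is a cosine. -/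
theorem canonAddChar_re (p : ℕ) (E : Type*) [Field E] [CharP E p] (x : E) :
    letI := ZMod.algebra E p
    (canonAddChar p E x).re =
      Real.cos (2 * Real.pi * ((Algebra.trace (ZMod p) E x).val : ℝ) / p) := by
  let := ZMod.algebra E p
  rw [← Complex.exp_ofReal_mul_I_re, canonAddChar]
  congr 2
  push_cast
  ring

theorem canonAddChar_re_le_one (p : ℕ) (E : Type*) [Field E] [CharP E p] (x : E) :
    (canonAddChar p E x).re ≤ 1 := by
  rw [canonAddChar_re]
  exact Real.cos_le_one _

/-- The real part of the canonical additive character is one only on the kernel of the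
absolute trace. -/
theorem trace_eq_zero_of_canonAddChar_re_eq_one (p : ℕ) [Fact p.Prime] (E : Type*) [Field E]
    [CharP E p] (x : E) (h : (canonAddChar p E x).re = 1) :
    letI := ZMod.algebra E p
    Algebra.trace (ZMod p) E x = 0 := by
  let := ZMod.algebra E p
  rw [canonAddChar_re] at h
  have hp : (0 : ℝ) < p := by exact_mod_cast (Fact.out : p.Prime).pos
  have hv : ((Algebra.trace (ZMod p) E x).val : ℝ) < p := by
    exact_mod_cast ZMod.val_lt (Algebra.trace (ZMod p) E x)
  have hpi := Real.pi_pos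
  have hz := (Real.cos_eq_one_iff_of_lt_of_lt
    (lt_of_lt_of_le (neg_lt_zero.2 (by positivity)) (by positivity))
    (by rw [div_lt_iff₀ hp]; gcongr)).1 h
  rw [div_eq_zero_iff, or_iff_left hp.ne', mul_eq_zero, or_iff_right (by positivity)] at hz
  exact (ZMod.val_eq_zero _).1 (by exact_mod_cast hz)

theorem canonAddChar_eq_one (p : ℕ) (E : Type*) [Field E] [CharP E p] (x : E)
    (h : letI := ZMod.algebra E p; Algebra.trace (ZMod p) E x = 0) :
    canonAddChar p E x = 1 := by
  simp [canonAddChar, h]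

/-- In a finite separable extension, an element all of whose multiples have trace zero vanishes. -/
theorem eq_zero_of_forall_trace_mul_eq_zero {K L : Type*} [Field K] [Field L] [Algebra K L]
    [FiniteDimensional K L] [Algebra.IsSeparable K L] (y : L)
    (h : ∀ l : L, Algebra.trace K L (l * y) = 0) : y = 0 :=
  (traceForm_nondegenerate K L).2 y h

/-- Let `A` be an `F_q^*`-invariant (finite) subset of `F_{q^m}`.  Then
`L(A) = {a ∈ F_{q^m} : Ψ_a(A) = |A|}`. -/
theorem L_eq_charSum_set {p e m q : ℕ} [Fact p.Prime] (he : 0 < e) (hm : 0 < m)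
    (hq : q = p ^ e) {F E : Type*} [Field F] [Field E] [Fintype F] [Fintype E] [Algebra F E]
    [CharP E p] (hF : Fintype.card F = q) (hE : Fintype.card E = q ^ m)
    (A : Finset E)
    (hinv : ∀ l : F, l ≠ 0 → ∀ x ∈ A, algebraMap F E l * x ∈ A) :
    {x : E | ∀ s ∈ A, Algebra.trace F E (x * s) = 0} =
      {a : E | (∑ x ∈ A, canonAddChar p E (a * x)) = (A.card : ℂ)} := by
  have : CharP F p := (RingHom.charP_iff (algebraMap F E) (algebraMap F E).injective p).2 ‹_›
  let := ZMod.algebra E p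
  let := ZMod.algebra F p
  have : IsScalarTower (ZMod p) F E := IsScalarTower.of_algebraMap_eq' (Subsingleton.elim _ _)
  ext a
  simp only [Set.mem_ofPred_eq]
  constructor
  · intro h
    rw [Finset.sum_congr rfl fun x hx => canonAddChar_eq_one p E (a * x) ?_]
    · simp
    · rw [← Algebra.trace_trace (S := F), h x hx, map_zero]
  · intro h s hs
    have hre : ∑ x ∈ A, (canonAddChar p E (a * x)).re = ∑ x ∈ A, (1 : ℝ) := by
      simpa using congrArg Complex.re h
    have hone := (Finset.sum_eq_sum_iff_of_le
      fun x _ => canonAddChar_re_le_one p E (a * x)).1 hre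
    refine eq_zero_of_forall_trace_mul_eq_zero (K := ZMod p) _ fun l => ?_
    rcases eq_or_ne l 0 with rfl | hl
    · simp
    have ht := trace_eq_zero_of_canonAddChar_re_eq_one p E _ (hone _ (hinv l hl s hs))
    rwa [mul_left_comm, ← Algebra.smul_def, ← Algebra.trace_trace (S := F), map_smul,
      smul_eq_mul] at ht
end

section
/- Let D be an F_q^*-invariant subset of F_{q^m}^*, y ∈ F_q and z ∈ F_{q^m}^*. Then q·|D_{(y,z)}| = |D| − Ψ_z(D) if y ≠ 0, and q·|D_{(y,z)}| = |D| + (q−1)·Ψ_z(D) if y = 0. -/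
/-- Orthogonality count of a fibre of `f` over `-y`, when the sums of `ψ (l * f x)` over `D` do not
depend on the scalar `l ≠ 0`. -/
theorem AddChar.card_mul_card_filter_eq {F α : Type*} [Field F] [Fintype F] [DecidableEq F]
    {ψ : AddChar F ℂ} (hψ : ψ.IsPrimitive) (D : Finset α) (f : α → F)
    (h : ∀ l : F, l ≠ 0 → ∑ x ∈ D, ψ (l * f x) = ∑ x ∈ D, ψ (f x)) (y : F) :
    (Fintype.card F : ℂ) * ((D.filter (fun x => f x = -y)).card : ℂ) =
      (D.card : ℂ) + ((if y = 0 then (Fintype.card F : ℂ) else 0) - 1) * ∑ x ∈ D, ψ (f x) := by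
  have orth (b : F) : ∑ l : F, ψ (l * b) = if b = 0 then (Fintype.card F : ℂ) else 0 := by
    simpa using AddChar.sum_mulShift b hψ
  have swap : ∑ l : F, ψ (l * y) * ∑ x ∈ D, ψ (l * f x) =
      (Fintype.card F : ℂ) * ((D.filter (fun x => f x = -y)).card : ℂ) := by
    simp_rw [Finset.mul_sum, ← AddChar.map_add_eq_mul, ← mul_add]
    rw [Finset.sum_comm]
    simp_rw [orth, add_comm y, add_eq_zero_iff_eq_neg]
    rw [← Finset.sum_filter, Finset.sum_const, nsmul_eq_mul, mul_comm]
  have split : ∑ l : F, ψ (l * y) = 1 + ∑ l ∈ Finset.univ.erase 0, ψ (l * y) := by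
    rw [← Finset.add_sum_erase _ _ (Finset.mem_univ (0 : F))]
    simp
  rw [← swap, ← orth y, split, ← Finset.add_sum_erase _ _ (Finset.mem_univ (0 : F)),
    add_sub_cancel_left, Finset.sum_mul]
  congr 1
  · simp
  · exact Finset.sum_congr rfl fun l hl => by rw [h l (Finset.ne_of_mem_erase hl)]

/-- Over a finite field `F`, the canonical additive character of an extension factors through the
relative trace and a primitive additive character of `F`. -/
theorem exists_isPrimitive_canonAddChar_eq (p : ℕ) [Fact p.Prime] (F E : Type*) [Field F] [Field E]
    [Finite F] [Finite E] [Algebra F E] [CharP E p] :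
    ∃ ψ : AddChar F ℂ, ψ.IsPrimitive ∧
      ∀ x : E, canonAddChar p E x = ψ (Algebra.trace F E x) := by
  have : CharP F p := (algebraMap F E).charP (algebraMap F E).injective p
  let _ := ZMod.algebra F p
  let _ := ZMod.algebra E p
  have : IsScalarTower (ZMod p) F E := IsScalarTower.of_algebraMap_eq' (Subsingleton.elim _ _)
  let ψ : AddChar F ℂ :=
    (ZMod.stdAddChar (N := p)).compAddMonoidHom (Algebra.trace (ZMod p) F).toAddMonoidHom
  refine ⟨ψ, AddChar.IsPrimitive.of_ne_one ?_, fun x => ?_⟩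
  · obtain ⟨a, ha⟩ := Algebra.trace_surjective (ZMod p) F 1
    refine AddChar.ne_one_iff.2 ⟨a, fun h => one_ne_zero (α := ZMod p) ?_⟩
    rw [← ha]
    exact ZMod.injective_stdAddChar (h.trans (AddChar.map_zero_eq_one _).symm)
  · change _ = ZMod.stdAddChar (Algebra.trace (ZMod p) F (Algebra.trace F E x))
    rw [Algebra.trace_trace, ZMod.stdAddChar_apply, ZMod.toCircle_apply]
    rfl

/-- Let `D` be an `F_q^*`-invariant subset of `F_{q^m}^*`, `y ∈ F_q`,
`z ∈ F_{q^m}^*`.  Then `q·|D_{(y,z)}| = |D| − Ψ_z(D)` if `y ≠ 0`, and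
`q·|D_{(y,z)}| = |D| + (q−1)·Ψ_z(D)` if `y = 0`. -/
theorem card_Dyz_eq {p e m q : ℕ} [Fact p.Prime] (he : 0 < e) (hm : 0 < m)
    (hq : q = p ^ e) {F E : Type*} [Field F] [Field E] [Fintype F] [Fintype E]
    [DecidableEq F] [Algebra F E] [CharP E p]
    (hF : Fintype.card F = q) (hE : Fintype.card E = q ^ m)
    (D : Finset E) (hD0 : ∀ x ∈ D, x ≠ 0)
    (hinv : ∀ l : F, l ≠ 0 → ∀ x ∈ D, algebraMap F E l * x ∈ D)
    (y : F) (z : E) (hz : z ≠ 0) :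
    (y ≠ 0 →
      (q : ℂ) * ((D.filter (fun x => Algebra.trace F E (x * z) = -y)).card : ℂ) =
        (D.card : ℂ) - ∑ x ∈ D, canonAddChar p E (z * x)) ∧
    (y = 0 →
      (q : ℂ) * ((D.filter (fun x => Algebra.trace F E (x * z) = -y)).card : ℂ) =
        (D.card : ℂ) + ((q : ℂ) - 1) * ∑ x ∈ D, canonAddChar p E (z * x)) := by
  subst hF
  obtain ⟨ψ, hψ, htr⟩ := exists_isPrimitive_canonAddChar_eq p F E
  have scale (l : F) (hl : l ≠ 0) : ∑ x ∈ D, ψ (l * Algebra.trace F E (x * z)) =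
      ∑ x ∈ D, ψ (Algebra.trace F E (x * z)) := by
    have inj : Function.Injective (algebraMap F E l * ·) :=
      mul_right_injective₀ ((map_ne_zero _).2 hl)
    refine Finset.sum_nbij (algebraMap F E l * ·) (hinv l hl) inj.injOn
      (Finset.surjOn_of_injOn_of_card_le _ (hinv l hl) inj.injOn le_rfl) fun x _ => ?_
    rw [mul_assoc, ← Algebra.smul_def, map_smul, smul_eq_mul]
  have key := AddChar.card_mul_card_filter_eq hψ D (fun x => Algebra.trace F E (x * z)) scale y
  simp_rw [mul_comm z, htr]
  refine ⟨fun hy => ?_, fun hy => ?_⟩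
  · rw [key, if_neg hy]
    ring
  · rw [key, if_pos hy]
end

section
/- Let q = p^e with p prime, let m ≥ 4 with (m, q) ≠ (4, 2) and 2 | em, and set s = p^{em/2} = √(q^m). Suppose D ⊊ F_{q^m}^* is an F_q^*-invariant partial difference set with parameters (q^m, r(s − ε), εs + r² − 3εr, r² − εr), where ε ∈ {1, −1}. Then C(M_D) is a minimal linear code if one of the following holds: (1) ε = 1, r ≠ s, and r > 1; (2) ε = −1, r ≠ s − 1, and r > (q−1)s/(s + q). -/
open Finset in
/-- The intersection of the kernels of two independent functionals has index `q` in the first. -/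
theorem card_mul_card_ker_inter {F V : Type*} [Field F] [Fintype F] [DecidableEq F]
    [AddCommGroup V] [Module F V] [Fintype V] (f g : V →ₗ[F] F) {x₀ : V}
    (hf : f x₀ = 0) (hg : g x₀ ≠ 0) :
    Fintype.card F * #{x | f x = 0 ∧ g x = 0} = #{x | f x = 0} := by
  rw [card_eq_sum_card_fiberwise (s := {x | f x = 0}) (f := g) (t := univ)
    (fun _ _ => by simp)]
  have key (a : F) : #{x ∈ ({x | f x = 0} : Finset V) | g x = a} =
      #{x | f x = 0 ∧ g x = 0} := by
    refine card_bij' (fun x _ => x - (a / g x₀) • x₀) (fun x _ => x + (a / g x₀) • x₀) ?_ ?_ ?_ ?_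
    · intro x hx
      simp only [mem_filter, mem_univ, true_and] at hx
      simp [hf, hx.1, hx.2, hg]
    · intro x hx
      simp only [mem_filter, mem_univ, true_and] at hx
      simp [hf, hx.1, hx.2, hg]
    · simp
    · simp
  simp [key]

open Finset in
theorem card_mul_card_ker {F V : Type*} [Field F] [Fintype F] [DecidableEq F]
    [AddCommGroup V] [Module F V] [Fintype V] {g : V →ₗ[F] F} (hg : g ≠ 0) :
    Fintype.card F * #{x | g x = 0} = Fintype.card V := by
  obtain ⟨x₀, hx₀⟩ : ∃ x, g x ≠ 0 := by
    by_contra! h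
    exact hg (LinearMap.ext h)
  simpa using card_mul_card_ker_inter (0 : V →ₗ[F] F) g (x₀ := x₀) rfl hx₀

open Finset in
/-- On a scalar-invariant set, all nonzero fibres of a functional have the same size. -/
theorem card_fiber_eq_of_invariant {F V : Type*} [Field F] [DecidableEq F]
    [AddCommGroup V] [Module F V] {D : Finset V}
    (hinv : ∀ l : F, l ≠ 0 → ∀ x ∈ D, l • x ∈ D) (f : V →ₗ[F] F) {a : F} (ha : a ≠ 0) :
    #{d ∈ D | f d = a} = #{d ∈ D | f d = 1} := by
  refine card_bij' (fun x _ => a⁻¹ • x) (fun x _ => a • x) ?_ ?_ ?_ ?_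
  · intro x hx
    simp only [mem_filter] at hx ⊢
    exact ⟨hinv _ (inv_ne_zero ha) _ hx.1, by simp [hx.2, ha]⟩
  · intro x hx
    simp only [mem_filter] at hx ⊢
    exact ⟨hinv _ ha _ hx.1, by simp [hx.2]⟩
  · intro x _
    simp [smul_smul, ha]
  · intro x _
    simp [smul_smul, ha]

open Finset in
theorem sum_fiber_of_invariant {F V M : Type*} [Field F] [Fintype F] [DecidableEq F]
    [AddCommGroup V] [Module F V] [CommRing M] {D : Finset V}
    (hinv : ∀ l : F, l ≠ 0 → ∀ x ∈ D, l • x ∈ D) (f : V →ₗ[F] F) (h : ℕ → M) :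
    ∑ a : F, h #{d ∈ D | f d = a} =
      h #{d ∈ D | f d = 0} + ((Fintype.card F : M) - 1) * h #{d ∈ D | f d = 1} := by
  rw [← add_sum_erase univ _ (mem_univ (0 : F)),
    sum_congr rfl fun a ha => by
      rw [card_fiber_eq_of_invariant hinv f (ne_of_mem_erase ha)]]
  simp [card_erase_of_mem, Nat.cast_sub Fintype.card_pos]

open Finset in
theorem card_eq_fiber_of_invariant {F V : Type*} [Field F] [Fintype F] [DecidableEq F]
    [AddCommGroup V] [Module F V] {D : Finset V}
    (hinv : ∀ l : F, l ≠ 0 → ∀ x ∈ D, l • x ∈ D) (f : V →ₗ[F] F) :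
    (#D : ℤ) = #{d ∈ D | f d = 0} + ((Fintype.card F : ℤ) - 1) * #{d ∈ D | f d = 1} := by
  rw [← sum_fiber_of_invariant hinv f (fun n => (n : ℤ)),
    card_eq_sum_card_fiberwise (f := f) (t := univ) (fun _ _ => by simp)]
  push_cast
  rfl

open Finset in
/-- Counting pairs of a partial difference set whose difference lies in a hyperplane. -/
theorem sum_sq_fiber_of_pds {F V : Type*} [Field F] [Fintype F] [DecidableEq F]
    [AddCommGroup V] [Module F V] [Fintype V] [DecidableEq V] {D : Finset V}
    (hinv : ∀ l : F, l ≠ 0 → ∀ x ∈ D, l • x ∈ D) (hD0 : (0 : V) ∉ D) {A B : ℤ}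
    (hpds : ∀ g : V, g ≠ 0 → (#{pr ∈ D ×ˢ D | pr.1 - pr.2 = g} : ℤ) = if g ∈ D then A else B)
    (f : V →ₗ[F] F) :
    (#{d ∈ D | f d = 0} : ℤ) ^ 2 + ((Fintype.card F : ℤ) - 1) * #{d ∈ D | f d = 1} ^ 2 =
      #D + A * #{d ∈ D | f d = 0} + B * (#{x | f x = 0} - 1 - #{d ∈ D | f d = 0}) := by
  rw [← sum_fiber_of_invariant hinv f (fun n => (n : ℤ) ^ 2)]
  have by_value : (#{pr ∈ D ×ˢ D | f pr.1 = f pr.2} : ℤ) =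
      ∑ a : F, (#{d ∈ D | f d = a} : ℤ) ^ 2 := by
    rw [card_eq_sum_card_fiberwise (f := fun pr => f pr.1) (t := univ) (fun _ _ => by simp)]
    push_cast
    refine sum_congr rfl fun a _ => ?_
    rw [sq, ← Nat.cast_mul, ← card_product]
    congr 2
    ext ⟨x, y⟩
    simp only [mem_filter, mem_product]
    grind
  have by_difference : (#{pr ∈ D ×ˢ D | f pr.1 = f pr.2} : ℤ) =
      ∑ g with f g = 0, (#{pr ∈ D ×ˢ D | pr.1 - pr.2 = g} : ℤ) := by
    rw [card_eq_sum_card_fiberwise (f := fun pr => pr.1 - pr.2)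
      (t := ({g | f g = 0} : Finset V))
      (fun pr hpr => by
        simp only [coe_filter, Set.mem_ofPred_eq] at hpr
        simp [hpr.2])]
    push_cast
    refine sum_congr rfl fun g hg => ?_
    congr 2
    ext ⟨x, y⟩
    simp only [mem_filter, mem_univ, true_and] at hg ⊢
    constructor
    · rintro ⟨⟨h₁, -⟩, h₂⟩
      exact ⟨h₁, h₂⟩
    · rintro ⟨h₁, h₂⟩
      refine ⟨⟨h₁, ?_⟩, h₂⟩
      rw [← sub_eq_zero, ← map_sub, h₂, hg]
  have at_zero : (#{pr ∈ D ×ˢ D | pr.1 - pr.2 = 0} : ℤ) = #D := by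
    rw [← diag_card D]
    congr 2
    ext ⟨x, y⟩
    simp only [mem_filter, mem_product, mem_diag, sub_eq_zero]
    grind
  have hmem : (0 : V) ∈ ({g | f g = 0} : Finset V) := by simp
  rw [← by_value, by_difference, ← add_sum_erase _ _ hmem, at_zero,
    sum_congr rfl fun g hg => hpds g (ne_of_mem_erase hg), sum_ite, sum_const, sum_const]
  have h₁ : #{x ∈ ({g | f g = 0} : Finset V).erase 0 | x ∈ D} = #{d ∈ D | f d = 0} := by
    congr 1
    ext x
    simp only [mem_filter, mem_erase, mem_univ, true_and]
    grind
  have h₂ := card_filter_add_card_filter_not (s := ({g | f g = 0} : Finset V).erase 0) (· ∈ D)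
  have h₃ := card_erase_add_one hmem
  rw [h₁] at h₂ ⊢
  simp only [nsmul_eq_mul]
  have h₄ : (#{x ∈ ({g | f g = 0} : Finset V).erase 0 | x ∉ D} : ℤ) =
      #{x | f x = 0} - 1 - #{d ∈ D | f d = 0} := by omega
  rw [h₄]
  ring

open Finset in
/-- The nonprincipal eigenvalues of a partial difference set of Latin square type (`ε = 1`) or
negative Latin square type (`ε = -1`). -/
theorem eigenvalue_of_pds {F V : Type*} [Field F] [Fintype F] [DecidableEq F]
    [AddCommGroup V] [Module F V] [Fintype V] [DecidableEq V] {D : Finset V}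
    (hinv : ∀ l : F, l ≠ 0 → ∀ x ∈ D, l • x ∈ D) (hD0 : (0 : V) ∉ D) {r ε s : ℤ}
    (hs : (Fintype.card V : ℤ) = s ^ 2) (hε : ε = 1 ∨ ε = -1) (hk : (#D : ℤ) = r * (s - ε))
    (hpds : ∀ g : V, g ≠ 0 → (#{pr ∈ D ×ˢ D | pr.1 - pr.2 = g} : ℤ) =
      if g ∈ D then ε * s + r ^ 2 - 3 * ε * r else r ^ 2 - ε * r)
    {f : V →ₗ[F] F} (hf : f ≠ 0) :
    (#{d ∈ D | f d = 0} : ℤ) - #{d ∈ D | f d = 1} = ε * (s - r) ∨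
      (#{d ∈ D | f d = 0} : ℤ) - #{d ∈ D | f d = 1} = -(ε * r) := by
  have hsq := sum_sq_fiber_of_pds hinv hD0 hpds f
  have hcard := card_eq_fiber_of_invariant hinv f
  have hker : (Fintype.card F : ℤ) * #{x | f x = 0} = s ^ 2 := by
    rw [← hs]
    exact_mod_cast card_mul_card_ker hf
  have hq : (Fintype.card F : ℤ) - 1 ≠ 0 := by
    have := Fintype.one_lt_card (α := F)
    omega
  generalize (#{d ∈ D | f d = 0} : ℤ) = N at *
  generalize (#{d ∈ D | f d = 1} : ℤ) = n at *
  generalize (Fintype.card F : ℤ) = q at *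
  generalize (#D : ℤ) = k at *
  generalize (#{x | f x = 0} : ℤ) = H at *
  obtain rfl : N = k - (q - 1) * n := by linarith
  have hε2 : ε ^ 2 = 1 := by rcases hε with rfl | rfl <;> norm_num
  have hprod : (q - 1) * ((k - (q - 1) * n - n - ε * (s - r)) *
      (k - (q - 1) * n - n + ε * r)) = 0 := by
    subst hk
    rcases hε with rfl | rfl
    · linear_combination q * hsq + (r ^ 2 - r) * hker
    · linear_combination q * hsq + (r ^ 2 + r) * hker
  rcases mul_eq_zero.mp ((mul_eq_zero.mp hprod).resolve_left hq) with h | h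
  · left; linarith
  · right; linarith

open Finset in
/-- Sufficient conditions for the support inclusions in the code spanned by the indicator function
of `D` and the linear functionals to be trivial, in terms of the hyperplane sections of `D`. -/
theorem exists_smul_of_hyperplane_sections {F V : Type*} [Field F] [Fintype F] [DecidableEq F]
    [AddCommGroup V] [Module F V] [Fintype V] [DecidableEq V] {D : Finset V}
    (hinv : ∀ l : F, l ≠ 0 → ∀ x ∈ D, l • x ∈ D) (hD0 : (0 : V) ∉ D)
    (hmeet : ∀ f : V →ₗ[F] F, f ≠ 0 → ∃ d ∈ D, f d = 0)
    (hleave : ∀ f : V →ₗ[F] F, f ≠ 0 → ∃ d ∈ D, f d ≠ 0)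
    (hcompl : ∀ f : V →ₗ[F] F, f ≠ 0 → ∃ x, x ∉ D ∧ f x ≠ 0)
    (hdiff : ∀ f g : V →ₗ[F] F, f ≠ 0 → g ≠ 0 → ∀ x₀, f x₀ = 0 → g x₀ ≠ 0 →
      #{d ∈ D | f d = 0} < #{d ∈ D | g d = 0} + #{x | f x = 0 ∧ g x ≠ 0})
    (hbinary : Fintype.card F = 2 → ∀ f g : V →ₗ[F] F, f ≠ 0 → ∀ x₀, f x₀ = 0 → g x₀ ≠ 0 →
      ∃ x, f x = 0 ∧ (x ∈ D ↔ g x = 0) ∧ x ≠ 0)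
    {u u' : F} {f f' : V →ₗ[F] F} (hne : u ≠ 0 ∨ f ≠ 0)
    (hsupp : ∀ x, x ≠ 0 → u * (if x ∈ D then 1 else 0) + f x = 0 →
      u' * (if x ∈ D then 1 else 0) + f' x = 0) :
    ∃ a : F, u' = a * u ∧ f' = a • f := by
  have hker {g h : V →ₗ[F] F} (hgh : ∀ x, g x = 0 → h x = 0) : ∃ a : F, h = a • g := by
    have := (mem_span_of_iInf_ker_le_ker (ι := Unit) (L := fun _ => g) (K := h)
      (fun x hx => hgh x (by simpa using hx)))
    obtain ⟨a, ha⟩ := Submodule.mem_span_singleton.mp (by simpa using this)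
    exact ⟨a, ha.symm⟩
  by_cases hu : u = 0
  · subst hu
    have hf : f ≠ 0 := by simpa using hne
    have hsupp' (x : V) (hx : x ≠ 0) (hfx : f x = 0) :
        u' * (if x ∈ D then 1 else 0) + f' x = 0 := hsupp x hx (by simpa using hfx)
    by_cases hpar : ∀ x, f x = 0 → f' x = 0
    · obtain ⟨a, rfl⟩ := hker hpar
      obtain ⟨d, hd, hfd⟩ := hmeet f hf
      have := hsupp' d (fun h => hD0 (h ▸ hd)) hfd
      exact ⟨a, by simpa [hd, hfd] using this, rfl⟩
    · exfalso
      push Not at hpar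
      obtain ⟨x₀, hx₀, hgx₀⟩ := hpar
      have hx₀0 : x₀ ≠ 0 := by
        rintro rfl
        simp at hgx₀
      have h₁ := hsupp' x₀ hx₀0 hx₀
      have hscalar (l : F) (hl : l ≠ 0) : l = 1 := by
        have h₂ := hsupp' (l • x₀) (smul_ne_zero hl hx₀0) (by simp [hx₀])
        have hmem : l • x₀ ∈ D ↔ x₀ ∈ D :=
          ⟨fun h => by simpa [smul_smul, hl] using hinv l⁻¹ (inv_ne_zero hl) _ h, hinv l hl x₀⟩
        simp only [hmem, map_smul, smul_eq_mul] at h₂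
        have : (l - 1) * f' x₀ = 0 := by linear_combination h₂ - h₁
        exact sub_eq_zero.mp ((mul_eq_zero.mp this).resolve_right hgx₀)
      have hcard : Fintype.card F = 2 := by
        rw [← card_univ, show (univ : Finset F) = {0, 1} by
          ext l
          simpa [or_iff_not_imp_left] using hscalar l]
        exact card_pair zero_ne_one
      have hu' : u' ≠ 0 := by
        rintro rfl
        exact hgx₀ (by simpa using h₁)
      obtain ⟨x, hfx, hx, hx0⟩ := hbinary hcard f f' hf x₀ hx₀ hgx₀
      have h₃ := hsupp' x hx0 hfx
      by_cases hxD : x ∈ D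
      · exact hu' (by simpa [hxD, hx.mp hxD] using h₃)
      · exact hxD (hx.mpr (by simpa [hxD] using h₃))
  · obtain ⟨a, ha⟩ : ∃ a, u' = a * u := ⟨u' / u, by field_simp⟩
    refine ⟨a, ha, ?_⟩
    by_contra hne'
    set h := f' - a • f with hh
    have hh0 : h ≠ 0 := sub_ne_zero.mpr hne'
    have hsupp' (x : V) (hx : u * (if x ∈ D then 1 else 0) + f x = 0) : h x = 0 := by
      rcases eq_or_ne x 0 with rfl | hx0
      · simp
      · have := hsupp x hx0 hx
        simp only [hh, LinearMap.sub_apply, LinearMap.smul_apply, smul_eq_mul]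
        rw [ha] at this
        linear_combination this - a * hx
    have hin {d : V} (hd : d ∈ D) (hfd : f d ≠ 0) : h d = 0 := by
      have hl : -u / f d ≠ 0 := div_ne_zero (neg_ne_zero.mpr hu) hfd
      have := hsupp' ((-u / f d) • d) (by simp [hinv _ hl d hd, hfd])
      simpa [hu, hfd] using this
    have hout {x : V} (hx : x ∉ D) (hfx : f x = 0) : h x = 0 := hsupp' x (by simp [hx, hfx])
    by_cases hf : f = 0
    · obtain ⟨x, hx, hhx⟩ := hcompl h hh0
      exact hhx (hout hx (by simp [hf]))
    by_cases hpar : ∀ x, f x = 0 → h x = 0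
    · obtain ⟨b, hb⟩ := hker hpar
      obtain ⟨d, hd, hfd⟩ := hleave f hf
      have := hin hd hfd
      rw [hb, LinearMap.smul_apply, smul_eq_mul, mul_eq_zero, or_iff_left hfd] at this
      exact hh0 (by rw [hb, this, zero_smul])
    · push Not at hpar
      obtain ⟨x₀, hx₀, hhx₀⟩ := hpar
      have hg : f + h ≠ 0 := fun hg => hhx₀ (by simpa [hx₀] using LinearMap.congr_fun hg x₀)
      refine (hdiff f (f + h) hf hg x₀ hx₀ (by simpa [hx₀] using hhx₀)).not_ge ?_
      rw [← card_union_of_disjoint]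
      · refine card_le_card fun x hx => ?_
        simp only [mem_union, mem_filter, mem_univ, true_and, LinearMap.add_apply] at hx ⊢
        rcases hx with ⟨hxD, hx⟩ | ⟨hfx, hx⟩
        · refine ⟨hxD, ?_⟩
          by_contra hfx
          exact hfx (by simpa [hin hxD hfx] using hx)
        · refine ⟨?_, hfx⟩
          by_contra hxD
          exact hx (by simp [hfx, hout hxD hfx])
      · rw [disjoint_left]
        intro x hx
        simp only [mem_filter, mem_univ, true_and, not_and, not_not] at hx ⊢
        exact fun _ => hx.2

/-- The arithmetic of a hyperplane section of size `N`, with nonzero fibres of size `n`. -/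
theorem hyperplane_section_bounds {q s r ε k N n : ℤ} (hq : 2 ≤ q) (hqs : q ^ 2 ≤ s)
    (hk : k = r * (s - ε)) (hlt : k < s ^ 2 - 1)
    (hr : (ε = 1 ∧ r ≠ s ∧ 1 < r) ∨ (ε = -1 ∧ r ≠ s - 1 ∧ (q - 1) * s < r * (s + q)))
    (hN : k = N + (q - 1) * n) (hθ : N - n = ε * (s - r) ∨ N - n = -(ε * r)) :
    N ≠ 0 ∧ n ≠ 0 ∧ q * n ≠ s ^ 2 ∧ |N - n| < s := by
  have hqs' : q < s := by nlinarith
  have hN' : q * N = k + (q - 1) * (N - n) := by linarith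
  have hn' : q * n = k - (N - n) := by linarith
  have hr0 : 0 < r ∧ r < s := by
    rcases hr with ⟨rfl, h₁, h₂⟩ | ⟨rfl, h₁, h₂⟩
    · have : r < s + 1 := by nlinarith
      omega
    · refine ⟨?_, by nlinarith⟩
      by_contra! h
      nlinarith
  obtain ⟨hr0, hrs⟩ := hr0
  have hN0 : 0 < q * N := by
    rw [hN', hk]
    rcases hr with ⟨rfl, h₁, h₂⟩ | ⟨rfl, h₁, h₂⟩ <;> rcases hθ with h | h <;> rw [h] <;> nlinarith
  have hn0 : 0 < q * n := by
    rw [hn', hk]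
    rcases hr with ⟨rfl, h₁, h₂⟩ | ⟨rfl, h₁, h₂⟩ <;> rcases hθ with h | h <;> rw [h] <;> nlinarith
  refine ⟨by rintro rfl; simp at hN0, by rintro rfl; simp at hn0, ?_, ?_⟩
  · rw [hn', hk]
    rcases hr with ⟨rfl, h₁, h₂⟩ | ⟨rfl, h₁, h₂⟩ <;> rcases hθ with h | h <;> rw [h]
    · intro h₃
      have : s * (r - (s + 1)) = 0 := by linear_combination h₃
      rcases mul_eq_zero.mp this with h₄ | h₄ <;> omega
    · intro h₃
      have : s * (r - s) = 0 := by linear_combination h₃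
      rcases mul_eq_zero.mp this with h₄ | h₄ <;> omega
    · intro h₃
      have : s * (r - (s - 1)) = 0 := by linear_combination h₃
      rcases mul_eq_zero.mp this with h₄ | h₄ <;> omega
    · intro h₃
      have : s * (r - s) = 0 := by linear_combination h₃
      rcases mul_eq_zero.mp this with h₄ | h₄ <;> omega
  · rw [abs_lt]
    rcases hr with ⟨rfl, -⟩ | ⟨rfl, -⟩ <;> rcases hθ with h | h <;> rw [h] <;>
      constructor <;> linarith

theorem hyperplane_section_sub_le {q s r ε k N n N' n' : ℤ} (hq : 2 ≤ q) (hs : 0 ≤ s)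
    (hε : ε = 1 ∨ ε = -1)
    (hN : k = N + (q - 1) * n) (hθ : N - n = ε * (s - r) ∨ N - n = -(ε * r))
    (hN' : k = N' + (q - 1) * n') (hθ' : N' - n' = ε * (s - r) ∨ N' - n' = -(ε * r)) :
    q * (N - N') ≤ (q - 1) * s := by
  have h : (N - n) - (N' - n') ≤ s := by
    rcases hε with rfl | rfl <;> rcases hθ with h | h <;> rcases hθ' with h' | h' <;>
      rw [h, h'] <;> linarith
  have : q * (N - N') = (q - 1) * ((N - n) - (N' - n')) := by linarith
  rw [this]
  exact mul_le_mul_of_nonneg_left h (by linarith)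

open Finset in
theorem exists_smul_of_latin_square_type_pds {F V : Type*} [Field F] [Fintype F] [DecidableEq F]
    [AddCommGroup V] [Module F V] [Fintype V] [DecidableEq V] {D : Finset V}
    (hinv : ∀ l : F, l ≠ 0 → ∀ x ∈ D, l • x ∈ D) (hD0 : (0 : V) ∉ D) {r ε s : ℤ}
    (hs : (Fintype.card V : ℤ) = s ^ 2) (hqs : (Fintype.card F : ℤ) ^ 2 ≤ s) (hs8 : 8 ≤ s)
    (hk : (#D : ℤ) = r * (s - ε)) (hlt : (#D : ℤ) < s ^ 2 - 1)
    (hpds : ∀ g : V, g ≠ 0 → (#{pr ∈ D ×ˢ D | pr.1 - pr.2 = g} : ℤ) =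
      if g ∈ D then ε * s + r ^ 2 - 3 * ε * r else r ^ 2 - ε * r)
    (hr : (ε = 1 ∧ r ≠ s ∧ 1 < r) ∨
      (ε = -1 ∧ r ≠ s - 1 ∧ ((Fintype.card F : ℤ) - 1) * s < r * (s + Fintype.card F)))
    {u u' : F} {f f' : V →ₗ[F] F} (hne : u ≠ 0 ∨ f ≠ 0)
    (hsupp : ∀ x, x ≠ 0 → u * (if x ∈ D then 1 else 0) + f x = 0 →
      u' * (if x ∈ D then 1 else 0) + f' x = 0) :
    ∃ a : F, u' = a * u ∧ f' = a • f := by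
  have hε : ε = 1 ∨ ε = -1 := hr.imp And.left And.left
  have hq : 2 ≤ (Fintype.card F : ℤ) := by exact_mod_cast Fintype.one_lt_card (α := F)
  have heig {f : V →ₗ[F] F} (hf : f ≠ 0) := eigenvalue_of_pds hinv hD0 hs hε hk hpds hf
  have hcard := card_eq_fiber_of_invariant hinv
  have hbounds {f : V →ₗ[F] F} (hf : f ≠ 0) :=
    hyperplane_section_bounds hq hqs hk hlt hr (hcard f) (heig hf)
  have hsub {f g : V →ₗ[F] F} (hf : f ≠ 0) (hg : g ≠ 0) :=
    hyperplane_section_sub_le hq (by linarith) hε (hcard f) (heig hf) (hcard g) (heig hg)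
  have hker {f : V →ₗ[F] F} (hf : f ≠ 0) :
      (Fintype.card F : ℤ) * #{x | f x = 0} = s ^ 2 := by
    rw [← hs]
    exact_mod_cast card_mul_card_ker hf
  have hkerdiff {f g : V →ₗ[F] F} (hf : f ≠ 0) {x₀ : V} (hx₀ : f x₀ = 0) (hgx₀ : g x₀ ≠ 0) :
      (Fintype.card F : ℤ) ^ 2 * #{x | f x = 0 ∧ g x ≠ 0} = (Fintype.card F - 1) * s ^ 2 := by
    have h₁ : (Fintype.card F : ℤ) * #{x | f x = 0 ∧ g x = 0} = #{x | f x = 0} := by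
      exact_mod_cast card_mul_card_ker_inter f g hx₀ hgx₀
    have h₂ : (#{x | f x = 0 ∧ g x = 0} : ℤ) + #{x | f x = 0 ∧ g x ≠ 0} = #{x | f x = 0} := by
      have := card_filter_add_card_filter_not (s := ({x | f x = 0} : Finset V)) (fun x => g x = 0)
      rw [filter_filter, filter_filter] at this
      exact_mod_cast this
    linear_combination (Fintype.card F : ℤ) ^ 2 * h₂ - (Fintype.card F : ℤ) * h₁ +
      ((Fintype.card F : ℤ) - 1) * hker hf
  have hindep {f g : V →ₗ[F] F} {x₀ : V} (hgx₀ : g x₀ ≠ 0) : g ≠ 0 := by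
    rintro rfl
    exact hgx₀ rfl
  refine exists_smul_of_hyperplane_sections hinv hD0 ?_ ?_ ?_ ?_ ?_ hne hsupp
  · intro f hf
    by_contra! h
    refine (hbounds hf).1 ?_
    rw [filter_false_of_mem h, card_empty, Nat.cast_zero]
  · intro f hf
    by_contra! h
    refine (hbounds hf).2.1 ?_
    rw [filter_false_of_mem fun d hd => by simp [h d hd], card_empty, Nat.cast_zero]
  · intro f hf
    by_contra! h
    refine (hbounds hf).2.2.1 ?_
    have h₁ : #{d ∈ D | ¬f d = 0} = #{x | ¬f x = 0} := by
      congr 1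
      ext x
      simp only [mem_filter, mem_univ, true_and, and_iff_right_iff_imp]
      intro hx
      by_contra hxD
      exact hx (h x hxD)
    have h₂ := card_filter_add_card_filter_not (s := D) (fun x => f x = 0)
    have h₃ := card_filter_add_card_filter_not (s := (univ : Finset V)) (fun x => f x = 0)
    rw [card_univ] at h₃
    have h₄ : ((Fintype.card F : ℤ) - 1) * (Fintype.card F * #{d ∈ D | f d = 1} - s ^ 2) = 0 := by
      zify at h₁ h₂ h₃
      linear_combination -(Fintype.card F : ℤ) * hcard f - (Fintype.card F : ℤ) * h₂ +
        (Fintype.card F : ℤ) * h₁ + (Fintype.card F : ℤ) * h₃ + (Fintype.card F : ℤ) * hs - hker hf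
    linarith [(mul_eq_zero.mp h₄).resolve_left (by linarith)]
  · intro f g hf hg x₀ hx₀ hgx₀
    by_contra! h
    have h₁ := hkerdiff hf hx₀ hgx₀
    have h₂ := hsub hf hg
    zify at h
    generalize (Fintype.card F : ℤ) = q at *
    have h₃ : (q - 1) * s ^ 2 ≤ q * ((q - 1) * s) := by
      rw [← h₁]
      nlinarith
    have h₄ : q < s := by nlinarith
    nlinarith [mul_pos (show 0 < q - 1 by linarith) (show 0 < s by linarith)]
  · intro hF2 f g hf x₀ hx₀ hgx₀
    by_contra! h
    have hx (x : V) (hfx : f x = 0) : x ∈ D ↔ g x ≠ 0 := by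
      rcases eq_or_ne x 0 with rfl | hx0
      · simp [hD0]
      · have := mt (h x hfx) hx0
        tauto
    have hg : g ≠ 0 := hindep (f := f) hgx₀
    have hfg : f + g ≠ 0 := hindep (f := f) (x₀ := x₀) (by simpa [hx₀] using hgx₀)
    have h₁ := hkerdiff hf hx₀ hgx₀
    have h₂ : #{d ∈ D | f d = 0} = #{x | f x = 0 ∧ g x ≠ 0} := by
      congr 1
      ext x
      simp only [mem_filter, mem_univ, true_and]
      have := hx x
      tauto
    have h₃ : #{d ∈ D | f d = 0} + #{d ∈ D | g d = 0} + #{d ∈ D | (f + g) d = 0} ≤ #D := by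
      rw [← card_union_of_disjoint, ← card_union_of_disjoint]
      · refine card_le_card fun x hx' => ?_
        simp only [mem_union, mem_filter] at hx'
        tauto
      · rw [disjoint_left]
        intro x
        simp only [mem_union, mem_filter, LinearMap.add_apply]
        rintro (⟨hxD, h₄⟩ | ⟨hxD, h₄⟩) ⟨-, h₅⟩
        · exact (hx x h₄).mp hxD (by simpa [h₄] using h₅)
        · exact (hx x (by simpa [h₄] using h₅)).mp hxD h₄
      · rw [disjoint_left]
        intro x
        simp only [mem_filter]
        rintro ⟨hxD, h₄⟩ ⟨-, h₅⟩
        exact (hx x h₄).mp hxD h₅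
    have h₄ := hsub hf hg
    have h₅ := hsub hf hfg
    have h₆ := (abs_lt.mp (hbounds hf).2.2.2).1
    have h₇ := hcard f
    rw [← h₂] at h₁
    rw [hF2] at h₁ h₄ h₅ h₇
    zify at h₃
    push_cast at *
    nlinarith


/-- The codeword `c(u,v)` of the code `C(M_D)`. -/
noncomputable def codewordMD (F E : Type*) [Field F] [Field E] [DecidableEq E] [Algebra F E]
    (D : Finset E) (w : F × E) : {x : E // x ≠ 0} → F :=
  fun x => w.1 * (if (x : E) ∈ D then (1 : F) else 0) + Algebra.trace F E (w.2 * (x : E))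

open Finset in
/-- Let `q = p^e`, `m ≥ 4` with `(m,q) ≠ (4,2)` and `2 ∣ em`, and set
`s = p^{em/2} = √(q^m)`.  Suppose `D ⊊ F_{q^m}^*` is an `F_q^*`-invariant
partial difference set with parameters
`(q^m, r(s−ε), εs + r² − 3εr, r² − εr)` where `ε ∈ {1,−1}`.  Then `C(M_D)` is
minimal if either (1) `ε = 1`, `r ≠ s` and `r > 1`, or (2) `ε = −1`,
`r ≠ s − 1` and `r > (q−1)s/(s+q)`. -/
theorem minimal_of_latin_square_type_pds {p e m q : ℕ} [Fact p.Prime] (he : 0 < e)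
    (hm : 4 ≤ m) (hmq : ¬(m = 4 ∧ q = 2)) (hq : q = p ^ e) (hem : 2 ∣ e * m)
    {F E : Type*} [Field F] [Field E] [Fintype F] [Fintype E]
    [DecidableEq E] [Algebra F E]
    (hF : Fintype.card F = q) (hE : Fintype.card E = q ^ m)
    (D : Finset E) (hD0 : ∀ x ∈ D, x ≠ 0)
    (hDproper : (D : Set E) ≠ {x : E | x ≠ 0}) (hDneg : ∀ d ∈ D, -d ∈ D)
    (hinv : ∀ l : F, l ≠ 0 → ∀ x ∈ D, algebraMap F E l * x ∈ D)
    (r ε : ℤ) (hε : ε = 1 ∨ ε = -1)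
    (hk : (D.card : ℤ) = r * ((p ^ (e * m / 2) : ℕ) - ε))
    (hpds : ∀ g : E, g ≠ 0 →
      (((D ×ˢ D).filter (fun pr => pr.1 - pr.2 = g)).card : ℤ) =
        if g ∈ D then ε * (p ^ (e * m / 2) : ℕ) + r ^ 2 - 3 * ε * r else r ^ 2 - ε * r)
    (hcond :
      (ε = 1 ∧ r ≠ ((p ^ (e * m / 2) : ℕ) : ℤ) ∧ 1 < r) ∨
      (ε = -1 ∧ r ≠ ((p ^ (e * m / 2) : ℕ) : ℤ) - 1 ∧
        (r : ℚ) > (((q : ℚ) - 1) * (p ^ (e * m / 2) : ℕ)) /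
          (((p ^ (e * m / 2) : ℕ) : ℚ) + (q : ℚ)))) :
    ∀ w : F × E, codewordMD F E D w ≠ 0 → ∀ w' : F × E,
      Function.support (codewordMD F E D w') ⊆ Function.support (codewordMD F E D w) →
        ∃ a : F, codewordMD F E D w' = a • codewordMD F E D w := by
  classical
  have hs : (Fintype.card E : ℤ) = ((p ^ (e * m / 2) : ℕ) : ℤ) ^ 2 := by
    rw [hE, hq, ← Nat.cast_pow, ← pow_mul, ← pow_mul, Nat.div_mul_cancel hem]
  have hqs : q ^ 2 ≤ p ^ (e * m / 2) := by
    rw [hq, ← pow_mul]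
    refine Nat.pow_le_pow_right (Fact.out : p.Prime).pos ?_
    rw [Nat.le_div_iff_mul_le two_pos]
    nlinarith
  have hq2 : 2 ≤ q := hF ▸ Fintype.one_lt_card
  have hs8 : 8 ≤ p ^ (e * m / 2) := by
    rcases hq2.eq_or_lt with h | h
    · obtain ⟨rfl, rfl⟩ := (Nat.prime_two.pow_eq_iff).mp (hq.symm.trans h.symm)
      calc 8 = 2 ^ 3 := by norm_num
        _ ≤ 2 ^ (1 * m / 2) := Nat.pow_le_pow_right two_pos (by omega)
    · nlinarith
  have hD0' : (0 : E) ∉ D := fun h => hD0 0 h rfl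
  have hlt : (#D : ℤ) < ((p ^ (e * m / 2) : ℕ) : ℤ) ^ 2 - 1 := by
    have hss : D ⊂ univ.erase 0 := by
      refine Finset.ssubset_iff_subset_ne.mpr ⟨fun x hx => by simp [hD0 x hx], ?_⟩
      rintro rfl
      exact hDproper (by ext x; simp)
    have h₁ := card_lt_card hss
    have h₂ := card_erase_add_one (mem_univ (0 : E))
    rw [card_univ] at h₂
    rw [← hs]
    omega
  have hr : (ε = 1 ∧ r ≠ ((p ^ (e * m / 2) : ℕ) : ℤ) ∧ 1 < r) ∨
      (ε = -1 ∧ r ≠ ((p ^ (e * m / 2) : ℕ) : ℤ) - 1 ∧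
        ((Fintype.card F : ℤ) - 1) * (p ^ (e * m / 2) : ℕ) <
          r * ((p ^ (e * m / 2) : ℕ) + Fintype.card F)) := by
    refine hcond.imp_right fun ⟨h₁, h₂, h₃⟩ => ⟨h₁, h₂, ?_⟩
    rw [gt_iff_lt, div_lt_iff₀ (by positivity)] at h₃
    rw [hF]
    exact_mod_cast h₃
  rintro ⟨u, v⟩ hw ⟨u', v'⟩ hsub
  let T (y : E) : E →ₗ[F] F := Algebra.trace F E ∘ₗ LinearMap.mulLeft F y
  obtain ⟨a, ha, hT⟩ : ∃ a : F, u' = a * u ∧ T v' = a • T v := by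
    refine exists_smul_of_latin_square_type_pds
      (fun l hl x hx => by simpa [Algebra.smul_def] using hinv l hl x hx) hD0' hs
      (by rw [hF]; exact_mod_cast hqs) (by exact_mod_cast hs8) hk hlt hpds hr ?_ ?_
    · by_contra! h
      refine hw (funext fun x => ?_)
      have := LinearMap.congr_fun h.2 (x : E)
      simpa [codewordMD, h.1, T] using this
    · intro x hx h
      by_contra h'
      exact hsub (a := ⟨x, hx⟩) h' h
  refine ⟨a, funext fun x => ?_⟩
  have := LinearMap.congr_fun hT (x : E)
  simp only [T, LinearMap.comp_apply, LinearMap.mulLeft_apply, LinearMap.smul_apply,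
    smul_eq_mul] at this
  simp only [codewordMD, Pi.smul_apply, smul_eq_mul, ha, this]
  ring
end

section
/- Let D be a proper F_q^*-invariant subset of F_{q^m}^*, and for (u,v) ∈ F_q × F_{q^m} define H_{u,v}(x) = u·f_D(x) + Tr(vx) for x ∈ F_{q^m}^*. Let x₁ and x' be distinct elements of F_{q^m}^*. Then the number of pairs (u,v) ∈ F_q × F_{q^m} with H_{u,v}(x₁) = 1 and H_{u,v}(x') ≠ 0 equals q^m if x₁ ∈ D̄ and x' = a·x₁ for some a ∈ F_q^*, and equals q^m − q^{m−1} otherwise. -/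
/-- For a surjective linear map, preimages have size proportional to
the size of the target set. -/
theorem LinearMap.card_preimage_mul_card {K V W : Type*} [Field K] [AddCommGroup V] [Module K V]
    [AddCommGroup W] [Module K W] (f : V →ₗ[K] W)
    (hf : Function.Surjective f) (S : Set W) :
    Nat.card {v : V // f v ∈ S} * Nat.card W = Nat.card S * Nat.card V := by
  have key : ∀ T : Set W, Nat.card {v : V // f v ∈ T} =
      Nat.card T * Nat.card (LinearMap.ker f) := by
    intro T
    obtain ⟨g, hg⟩ := f.exists_rightInverse_of_surjective (LinearMap.range_eq_top.2 hf)
    have hg' : ∀ w, f (g w) = w := fun w => LinearMap.congr_fun hg w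
    rw [← Nat.card_prod]
    exact Nat.card_congr
      { toFun := fun v => (⟨f v, v.2⟩, ⟨v - g (f v), by simp [hg']⟩)
        invFun := fun z => ⟨g z.1 + z.2, by
          have h := LinearMap.mem_ker.1 z.2.2
          simp [hg', h]⟩
        left_inv := fun v => by simp
        right_inv := fun z => by
          have h := LinearMap.mem_ker.1 z.2.2
          ext <;> simp [hg', h] }
  have hV : Nat.card V = Nat.card W * Nat.card (LinearMap.ker f) := by
    have h := key Set.univ
    rwa [Nat.card_congr (Equiv.Set.univ W),
      Nat.card_congr (Equiv.subtypeUnivEquiv fun _ => Set.mem_univ _)] at h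
  rw [key, hV]
  ring

/-- An element of a finite extension of a finite field is determined to be zero by its traces. -/
theorem FiniteField.eq_zero_of_forall_trace_mul_eq_zero {F E : Type*} [Field F] [Field E]
    [Finite F] [Finite E] [Algebra F E] {x : E}
    (h : ∀ v : E, Algebra.trace F E (v * x) = 0) : x = 0 :=
  (traceForm_nondegenerate F E).2 x h

/-- The functional `(u, v) ↦ u * c + Tr (v * x)`. -/
noncomputable def FiniteField.traceFunctional {F E : Type*} [Field F] [Field E] [Algebra F E]
    (c : F) (x : E) : F × E →ₗ[F] F :=
  (LinearMap.mulRight F c).coprod (Algebra.trace F E ∘ₗ LinearMap.mulRight F x)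

theorem FiniteField.traceFunctional_apply {F E : Type*} [Field F] [Field E] [Algebra F E]
    (c : F) (x : E) (w : F × E) :
    traceFunctional c x w = w.1 * c + Algebra.trace F E (w.2 * x) := by
  simp [traceFunctional]

theorem FiniteField.traceFunctional_surjective {F E : Type*} [Field F] [Field E]
    [Finite F] [Finite E] [Algebra F E] (c : F) {x : E} (hx : x ≠ 0) :
    Function.Surjective (traceFunctional c x) := by
  apply LinearMap.surjective
  intro h
  apply hx
  apply eq_zero_of_forall_trace_mul_eq_zero (F := F)
  intro v
  simpa [traceFunctional_apply] using LinearMap.congr_fun h (0, v)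

/-- Two trace functionals whose coefficient vectors are linearly independent are jointly
surjective. -/
theorem FiniteField.traceFunctional_prod_surjective {F E : Type*} [Field F] [Field E]
    [Finite F] [Finite E] [Algebra F E] {c d : F} {x y : E}
    (h : ∀ α β : F, α * c + β * d = 0 → α • x + β • y = 0 → α = 0 ∧ β = 0) :
    Function.Surjective ((traceFunctional c x).prod (traceFunctional d y)) := by
  rw [← LinearMap.range_eq_top]
  by_contra hr
  obtain ⟨φ, hφ, hle⟩ := Submodule.exists_le_ker_of_lt_top _ (lt_top_iff_ne_top.2 hr)
  have hφ' : ∀ z : F × F, φ z = φ (1, 0) * z.1 + φ (0, 1) * z.2 := by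
    intro z
    have hz : z = z.1 • ((1 : F), (0 : F)) + z.2 • ((0 : F), (1 : F)) := by ext <;> simp
    conv_lhs => rw [hz, map_add, map_smul, map_smul]
    simp only [smul_eq_mul]
    ring
  have hvan : ∀ w : F × E, φ (1, 0) * traceFunctional c x w +
      φ (0, 1) * traceFunctional d y w = 0 := by
    intro w
    have hw := LinearMap.mem_ker.1 (hle (LinearMap.mem_range_self _ w))
    rw [hφ'] at hw
    exact hw
  have hzero : φ (1, 0) = 0 ∧ φ (0, 1) = 0 := by
    apply h
    · simpa [traceFunctional_apply] using hvan (1, 0)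
    · apply eq_zero_of_forall_trace_mul_eq_zero (F := F)
      intro v
      simpa [traceFunctional_apply, mul_add] using hvan (0, v)
  apply hφ
  ext <;> simp [hzero.1, hzero.2]

/-- Let `D` be a proper `F_q^*`-invariant subset of `F_{q^m}^*` and, for
`(u,v) ∈ F_q × F_{q^m}`, let `H_{u,v}(x) = u·f_D(x) + Tr(v·x)`.  For distinct
`x₁, x' ∈ F_{q^m}^*`, the number of pairs `(u,v)` with `H_{u,v}(x₁) = 1` and
`H_{u,v}(x') ≠ 0` equals `q^m` if `x₁ ∈ D̄` and `x' = a·x₁` for some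
`a ∈ F_q^*`, and equals `q^m − q^{m−1}` otherwise. -/
theorem count_minimal_access_sets {p e m q : ℕ} [Fact p.Prime] (he : 0 < e) (hm : 0 < m)
    (hq : q = p ^ e) {F E : Type*} [Field F] [Field E] [Fintype F] [Fintype E] [Algebra F E]
    (hF : Fintype.card F = q) (hE : Fintype.card E = q ^ m)
    (D : Set E) (hD0 : D ⊆ {x : E | x ≠ 0}) (hDproper : D ≠ {x : E | x ≠ 0})
    (hinv : ∀ l : F, l ≠ 0 → ∀ x ∈ D, algebraMap F E l * x ∈ D)
    (x₁ x' : E) (hx₁ : x₁ ≠ 0) (hx' : x' ≠ 0) (hne : x₁ ≠ x') :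
    ((x₁ ∉ D ∧ ∃ a : F, a ≠ 0 ∧ x' = algebraMap F E a * x₁) →
      Nat.card {w : F × E //
          w.1 * D.indicator (fun _ => (1 : F)) x₁ + Algebra.trace F E (w.2 * x₁) = 1 ∧
          w.1 * D.indicator (fun _ => (1 : F)) x' + Algebra.trace F E (w.2 * x') ≠ 0} =
        q ^ m) ∧
    (¬ (x₁ ∉ D ∧ ∃ a : F, a ≠ 0 ∧ x' = algebraMap F E a * x₁) →
      Nat.card {w : F × E //
          w.1 * D.indicator (fun _ => (1 : F)) x₁ + Algebra.trace F E (w.2 * x₁) = 1 ∧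
          w.1 * D.indicator (fun _ => (1 : F)) x' + Algebra.trace F E (w.2 * x') ≠ 0} =
        q ^ m - q ^ (m - 1)) := by
  have hq0 : 0 < q := hF ▸ Fintype.card_pos
  have hcF : Nat.card F = q := by rw [Nat.card_eq_fintype_card, hF]
  have hcE : Nat.card E = q ^ m := by rw [Nat.card_eq_fintype_card, hE]
  set c := D.indicator (fun _ => (1 : F)) x₁ with hc
  set d := D.indicator (fun _ => (1 : F)) x' with hd
  simp only [← FiniteField.traceFunctional_apply]
  constructor
  · rintro ⟨hx₁D, a, ha, rfl⟩
    have hx'D : algebraMap F E a * x₁ ∉ D := fun h => hx₁D <| by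
      have h' := hinv a⁻¹ (inv_ne_zero ha) _ h
      rwa [← mul_assoc, ← map_mul, inv_mul_cancel₀ ha, map_one, one_mul] at h'
    have hdc : ∀ w : F × E, FiniteField.traceFunctional d (algebraMap F E a * x₁) w =
        a * FiniteField.traceFunctional c x₁ w := by
      intro w
      have htr : w.2 * (algebraMap F E a * x₁) = a • (w.2 * x₁) := by
        rw [Algebra.smul_def]
        ring
      rw [FiniteField.traceFunctional_apply, FiniteField.traceFunctional_apply, htr]
      simp [hc, hd, hx₁D, hx'D]
    have hcount := (FiniteField.traceFunctional c x₁).card_preimage_mul_card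
      (FiniteField.traceFunctional_surjective c hx₁) {1}
    have hset : ∀ w : F × E, (FiniteField.traceFunctional c x₁ w = 1 ∧
        FiniteField.traceFunctional d (algebraMap F E a * x₁) w ≠ 0) ↔
        FiniteField.traceFunctional c x₁ w ∈ ({1} : Set F) := by
      intro w
      rw [hdc, Set.mem_singleton_iff, and_iff_left_iff_imp]
      intro h
      simpa [h] using ha
    rw [Nat.card_congr (Equiv.subtypeEquivRight hset)]
    rw [Nat.card_prod, hcF, hcE, Nat.card_coe_set_eq, Set.ncard_singleton, one_mul, mul_comm] at hcount
    exact Nat.eq_of_mul_eq_mul_left hq0 hcount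
  · intro hnot
    have hind : ∀ α β : F, α * c + β * d = 0 → α • x₁ + β • x' = 0 → α = 0 ∧ β = 0 := by
      intro α β hαβ hx
      have hβ : β = 0 := by
        by_contra hβ
        have hx'eq : x' = algebraMap F E (-(β⁻¹ * α)) * x₁ := by
          rw [← Algebra.smul_def, neg_smul, mul_smul, eq_neg_of_add_eq_zero_left hx, smul_neg,
            neg_neg, inv_smul_smul₀ hβ]
        have ha : -(β⁻¹ * α) ≠ 0 := by
          intro ha
          rw [ha, map_zero, zero_mul] at hx'eq
          exact hx' hx'eq
        have hx₁D : x₁ ∈ D := by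
          by_contra hx₁D
          exact hnot ⟨hx₁D, _, ha, hx'eq⟩
        have hx'D : x' ∈ D := hx'eq ▸ hinv _ ha _ hx₁D
        rw [hc, hd, Set.indicator_of_mem hx₁D, Set.indicator_of_mem hx'D, mul_one, mul_one] at hαβ
        rw [eq_neg_of_add_eq_zero_left hαβ, mul_neg, neg_neg, inv_mul_cancel₀ hβ, map_one,
          one_mul] at hx'eq
        exact hne hx'eq.symm
      subst hβ
      simpa [hx₁] using hx
    have hcount := ((FiniteField.traceFunctional c x₁).prod
      (FiniteField.traceFunctional d x')).card_preimage_mul_card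
      (FiniteField.traceFunctional_prod_surjective hind) ({1} ×ˢ {0}ᶜ)
    have hset : ∀ w : F × E, (FiniteField.traceFunctional c x₁ w = 1 ∧
        FiniteField.traceFunctional d x' w ≠ 0) ↔
        ((FiniteField.traceFunctional c x₁).prod (FiniteField.traceFunctional d x')) w ∈
          ({1} ×ˢ {0}ᶜ : Set (F × F)) := by
      intro w
      simp
    have hS : Nat.card (({1} ×ˢ {0}ᶜ : Set (F × F))) = q - 1 := by
      rw [Nat.card_coe_set_eq, Set.ncard_prod, Set.ncard_singleton, one_mul, Set.ncard_compl,
        Set.ncard_singleton, hcF]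
    rw [Nat.card_congr (Equiv.subtypeEquivRight hset)]
    rw [hS, Nat.card_prod, Nat.card_prod, hcF, hcE] at hcount
    obtain ⟨n, rfl⟩ : ∃ n, m = n + 1 := ⟨m - 1, by omega⟩
    apply Nat.eq_of_mul_eq_mul_right (Nat.mul_pos hq0 hq0)
    rw [hcount, Nat.add_sub_cancel, pow_succ, ← Nat.mul_sub_one]
    ring
end
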